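/- For Re(c) > 0 and Re(s) > 0, and parameters satisfying a + b = 1 and d + e = 1 + 2c, ∫₀^∞ e^{-st} t^{c-1} ₂F₂(a, b; d, e; st) dt = s^{-c} π Γ(c) Γ(d) Γ(e) / (2^{2c-1} Γ((a+d)/2) Γ((a+e)/2) Γ((b+d)/2) Γ((b+e)/2)). -/

import Mathlib

open Complex Set MeasureTheory

/-- Pochhammer symbol `(a)_n` on the complex numbers. -/
noncomputable def poch (a : ℂ) (n : ℕ) : ℂ := (ascPochhammer ℂ n).eval a

/-- Generalized hypergeometric series with numerator parameters `as` and
denominator parameters `bs`, evaluated at `z`. -/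
noncomputable def hyp (as bs : List ℂ) (z : ℂ) : ℂ :=
  ∑' n : ℕ, ((as.map fun a => poch a n).prod /
    ((bs.map fun b => poch b n).prod * (n.factorial : ℂ))) * z ^ n

open Filter Topology Asymptotics

/-! ### Pochhammer symbols -/

lemma poch_zero (a : ℂ) : poch a 0 = 1 := by simp [poch]

lemma poch_succ (a : ℂ) (n : ℕ) : poch a (n + 1) = poch a n * (a + n) := by
  simp [poch, ascPochhammer_succ_eval]

lemma poch_ne_zero {d : ℂ} (hd : ∀ n : ℕ, d ≠ -(n : ℂ)) (n : ℕ) : poch d n ≠ 0 := by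
  induction n with
  | zero => simp [poch_zero]
  | succ n ih =>
    rw [poch_succ]
    exact mul_ne_zero ih fun h => hd n (eq_neg_of_add_eq_zero_left h)

lemma poch_add_one_mul (z : ℂ) (n : ℕ) : poch (z + 1) n * z = poch z n * (z + n) := by
  induction n with
  | zero => simp [poch_zero]
  | succ n ih =>
    rw [poch_succ, poch_succ]
    push_cast
    linear_combination (z + 1 + n) * ih

lemma poch_mul_Gamma {z : ℂ} (hz : ∀ n : ℕ, z ≠ -(n : ℂ)) (n : ℕ) :
    poch z n * Gamma z = Gamma (z + n) := by
  rw [poch, ← Gamma_add_nat_div_Gamma_eq z hz, div_mul_cancel₀ _ (Gamma_ne_zero hz)]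

lemma poch_eq_prod (z : ℂ) (n : ℕ) : poch z n = ∏ j ∈ Finset.range n, (z + j) := by
  induction n with
  | zero => simp [poch_zero]
  | succ n ih => rw [poch_succ, Finset.prod_range_succ, ih]

lemma GammaSeq_mul_poch {z : ℂ} {n : ℕ} (h : poch z (n + 1) ≠ 0) :
    GammaSeq z n * poch z (n + 1) = (n : ℂ) ^ z * n.factorial := by
  rw [GammaSeq, ← poch_eq_prod, div_mul_cancel₀ _ h]

lemma isBigO_poch_succ (a : ℂ) :
    (fun n : ℕ => poch a (n + 1)) =O[atTop]
      (fun n : ℕ => (n.factorial : ℝ) * (n : ℝ) ^ a.re) := by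
  by_cases ha : ∀ n : ℕ, a ≠ -(n : ℂ)
  · have h1 : Tendsto (fun n => (GammaSeq a n)⁻¹) atTop (𝓝 (Gamma a)⁻¹) :=
      (GammaSeq_tendsto_Gamma a).inv₀ (Gamma_ne_zero ha)
    have h2 := h1.isBigO_one ℝ
    have h3 : (fun n : ℕ => (n : ℂ) ^ a * n.factorial) =O[atTop]
        (fun n : ℕ => (n.factorial : ℝ) * (n : ℝ) ^ a.re) := by
      refine IsBigO.of_bound 1 ?_
      filter_upwards [eventually_gt_atTop 0] with n hn
      rw [norm_mul, norm_natCast_cpow_of_pos hn, Complex.norm_natCast, one_mul, mul_comm]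
      exact le_abs_self _
    refine ((h2.mul h3).congr' ?_ ?_)
    · filter_upwards [(GammaSeq_tendsto_Gamma a).eventually_ne (Gamma_ne_zero ha)] with n hn
      rw [← GammaSeq_mul_poch (poch_ne_zero ha (n + 1))]
      field_simp
    · filter_upwards with n
      ring
  · push Not at ha
    obtain ⟨m, rfl⟩ := ha
    refine IsBigO.of_bound 1 ?_
    filter_upwards [eventually_ge_atTop m] with n hn
    have : poch (-(m : ℂ)) (n + 1) = 0 := by
      rw [poch_eq_prod]
      exact Finset.prod_eq_zero (i := m) (by simp; omega) (by simp)
    rw [this]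
    simp only [norm_zero]
    positivity

lemma isBigO_inv_poch_succ {d : ℂ} (hd : ∀ n : ℕ, d ≠ -(n : ℂ)) :
    (fun n : ℕ => (poch d (n + 1))⁻¹) =O[atTop]
      (fun n : ℕ => ((n.factorial : ℝ) * (n : ℝ) ^ d.re)⁻¹) := by
  have h2 := (GammaSeq_tendsto_Gamma d).isBigO_one ℝ
  have h3 : (fun n : ℕ => ((n : ℂ) ^ d * n.factorial)⁻¹) =O[atTop]
      (fun n : ℕ => ((n.factorial : ℝ) * (n : ℝ) ^ d.re)⁻¹) := by
    refine IsBigO.of_bound 1 ?_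
    filter_upwards [eventually_gt_atTop 0] with n hn
    rw [norm_inv, norm_mul, norm_natCast_cpow_of_pos hn, Complex.norm_natCast, one_mul, mul_comm]
    exact le_abs_self _
  refine ((h2.mul h3).congr' ?_ ?_)
  · filter_upwards [eventually_gt_atTop 0] with n hn
    have h4 := GammaSeq_mul_poch (poch_ne_zero hd (n + 1))
    have h5 : (n : ℂ) ^ d * n.factorial ≠ 0 := by
      refine mul_ne_zero ?_ (by exact_mod_cast n.factorial_ne_zero)
      rw [Ne, cpow_eq_zero_iff]
      simp [hn.ne']
    rw [← h4] at h5 ⊢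
    have := left_ne_zero_of_mul h5
    have := right_ne_zero_of_mul h5
    field_simp
  · filter_upwards with n
    ring

/-! ### The terms of the `₃F₂(1)` series -/

/-- The `n`-th term of the series `₃F₂(a, b, c; d, e; 1)`. -/
noncomputable def hypTerm (a b c d e : ℂ) (n : ℕ) : ℂ :=
  poch a n * poch b n * poch c n / (poch d n * poch e n * n.factorial)

lemma hypTerm_zero (a b c d e : ℂ) : hypTerm a b c d e 0 = 1 := by simp [hypTerm, poch_zero]

lemma hypTerm_succ (a b c d e : ℂ) (n : ℕ) :
    hypTerm a b c d e (n + 1) = hypTerm a b c d e n *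
      ((a + n) * (b + n) * (c + n) / ((d + n) * (e + n) * (n + 1))) := by
  rw [hypTerm, hypTerm, div_mul_div_comm]
  simp only [poch_succ, Nat.factorial_succ]
  push_cast
  congr 1 <;> ring

lemma hypTerm_swap (a b c d e : ℂ) : hypTerm a b c d e = hypTerm a b c e d := by
  ext n
  rw [hypTerm, hypTerm, mul_comm (poch d n)]

lemma isBigO_hypTerm_succ (a b c : ℂ) {d e : ℂ} (hd : ∀ n : ℕ, d ≠ -(n : ℂ))
    (he : ∀ n : ℕ, e ≠ -(n : ℂ)) :
    (fun n : ℕ => hypTerm a b c d e (n + 1)) =O[atTop]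
      (fun n : ℕ => (n : ℝ) ^ ((a + b + c - d - e).re - 1)) := by
  have h1 : (fun n : ℕ => ((n + 1 : ℕ).factorial : ℂ)⁻¹) =O[atTop]
      (fun n : ℕ => ((n.factorial : ℝ) * (n : ℝ))⁻¹) := by
    refine IsBigO.of_bound 1 ?_
    filter_upwards [eventually_gt_atTop 0] with n hn
    rw [norm_inv, norm_inv, Complex.norm_natCast, one_mul]
    have : (0 : ℝ) < n := by exact_mod_cast hn
    have : (0 : ℝ) < n.factorial := by positivity
    rw [Real.norm_of_nonneg (by positivity), Nat.factorial_succ]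
    refine inv_anti₀ (by positivity) ?_
    push_cast
    nlinarith
  have h := ((((isBigO_poch_succ a).mul (isBigO_poch_succ b)).mul (isBigO_poch_succ c)).mul
    (((isBigO_inv_poch_succ hd).mul (isBigO_inv_poch_succ he)).mul h1))
  refine h.congr' ?_ ?_
  · filter_upwards with n
    rw [hypTerm, div_eq_mul_inv]
    simp only [mul_inv]
  · filter_upwards [eventually_gt_atTop 0] with n hn
    have hn : (0 : ℝ) < n := by exact_mod_cast hn
    have : (0 : ℝ) < n.factorial := by positivity
    have hr : (n : ℝ) ^ ((a + b + c - d - e).re - 1) =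
        (n : ℝ) ^ a.re * (n : ℝ) ^ b.re * (n : ℝ) ^ c.re / (n : ℝ) ^ d.re / (n : ℝ) ^ e.re / n := by
      rw [← Real.rpow_add hn, ← Real.rpow_add hn, ← Real.rpow_sub hn, ← Real.rpow_sub hn,
        ← Real.rpow_sub_one hn.ne']
      simp
    rw [hr]
    have := Real.rpow_pos_of_pos hn d.re
    have := Real.rpow_pos_of_pos hn e.re
    field_simp

lemma summable_hypTerm (a b c : ℂ) {d e : ℂ} (hd : ∀ n : ℕ, d ≠ -(n : ℂ))
    (he : ∀ n : ℕ, e ≠ -(n : ℂ)) (h : (a + b + c).re < (d + e).re) :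
    Summable (hypTerm a b c d e) := by
  rw [← summable_nat_add_iff 1]
  refine summable_of_isBigO_nat (Real.summable_nat_rpow.2 ?_) (isBigO_hypTerm_succ a b c hd he)
  simp at h ⊢
  linarith

lemma tendsto_nat_mul_hypTerm (a b c : ℂ) {d e : ℂ} (hd : ∀ n : ℕ, d ≠ -(n : ℂ))
    (he : ∀ n : ℕ, e ≠ -(n : ℂ)) (h : (a + b + c).re < (d + e).re) :
    Tendsto (fun n : ℕ => (n : ℂ) * hypTerm a b c d e n) atTop (𝓝 0) := by
  rw [← tendsto_add_atTop_iff_nat 1]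
  have h1 : (fun n : ℕ => ((n + 1 : ℕ) : ℂ)) =O[atTop] (fun n : ℕ => (n : ℝ)) := by
    refine IsBigO.of_bound 2 ?_
    filter_upwards [eventually_ge_atTop 1] with n hn
    have : (1 : ℝ) ≤ n := by exact_mod_cast hn
    rw [Complex.norm_natCast, Real.norm_of_nonneg (by positivity)]
    push_cast
    linarith
  refine (h1.mul (isBigO_hypTerm_succ a b c hd he)).trans_tendsto ?_
  have h2 : Tendsto (fun n : ℕ => (n : ℝ) ^ (-((d + e).re - (a + b + c).re))) atTop (𝓝 0) :=
    (tendsto_rpow_neg_atTop (by linarith)).comp tendsto_natCast_atTop_atTop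
  refine h2.congr' ?_
  filter_upwards [eventually_gt_atTop 0] with n hn
  have hn : (0 : ℝ) < n := by exact_mod_cast hn
  rw [Real.rpow_sub_one hn.ne', mul_div_cancel₀ _ hn.ne']
  congr 1
  simp
  ring

/-! ### Whipple's theorem -/

lemma hypTerm_shift (a b c : ℂ) {d : ℂ} (hd : ∀ n : ℕ, d ≠ -(n : ℂ)) (e : ℂ) (n : ℕ) :
    hypTerm a b (c + 1) (d + 2) e n * (c * ((d + n) * (d + n + 1))) =
      hypTerm a b c d e n * ((c + n) * (d * (d + 1))) := by
  have hd1 : ∀ n : ℕ, d + 1 ≠ -(n : ℂ) := fun n h => hd (n + 1) (by push_cast; linear_combination h)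
  have hd2 : ∀ n : ℕ, d + 2 ≠ -(n : ℂ) := fun n h => hd (n + 2) (by push_cast; linear_combination h)
  have h1 := poch_add_one_mul c n
  have h2 := poch_add_one_mul d n
  have h3 := poch_add_one_mul (d + 1) n
  rw [show d + 1 + 1 = d + 2 by ring] at h3
  have hp := poch_ne_zero hd n
  have hp2 := poch_ne_zero hd2 n
  rcases eq_or_ne (poch e n) 0 with he | he
  · simp [hypTerm, he]
  have hf : (n.factorial : ℂ) ≠ 0 := by exact_mod_cast n.factorial_ne_zero
  rw [hypTerm, hypTerm, div_mul_eq_mul_div, div_mul_eq_mul_div, div_eq_div_iff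
    (by positivity) (by positivity)]
  linear_combination (poch a n * poch b n * poch e n * n.factorial) *
    ((d + n) * (d + n + 1) * poch d n * h1 - poch c n * (c + n) * (d * h3 + (d + 1 + n) * h2))

lemma tsum_hypTerm_shift {a b c d e : ℂ} (hc : 0 < c.re) (hab : a + b = 1)
    (hde : d + e = 1 + 2 * c) (hd : ∀ n : ℕ, d ≠ -(n : ℂ)) (he : ∀ n : ℕ, e ≠ -(n : ℂ)) :
    d * (d + 1) * ∑' n, hypTerm a b c d e n =
      (a + d) * (b + d) * ∑' n, hypTerm a b (c + 1) (d + 2) e n := by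
  have hd2 : ∀ n : ℕ, d + 2 ≠ -(n : ℂ) := fun n h => hd (n + 2) (by push_cast; linear_combination h)
  have hc0 : c ≠ 0 := by rintro rfl; simp at hc
  have hre : (d + e).re = 1 + 2 * c.re := by rw [hde]; simp
  have hre' : (a + b).re = 1 := by rw [hab]; simp
  have s1 : (a + b + c).re < (d + e).re := by
    rw [hre, add_re, hre']; linarith
  have s2 : (a + b + (c + 1)).re < (d + 2 + e).re := by
    simp at hre hre' ⊢
    linarith
  have S1 := summable_hypTerm a b c hd he s1
  have S2 := summable_hypTerm a b (c + 1) hd2 he s2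
  set g : ℕ → ℂ := fun n =>
    d * (d + 1) * (e + n - 1) / (c * (d + n)) * (n * hypTerm a b c d e n) with hg
  have hstep : ∀ n, g (n + 1) - g n =
      (a + d) * (b + d) * hypTerm a b (c + 1) (d + 2) e n - d * (d + 1) * hypTerm a b c d e n := by
    intro n
    have e1 : d + n ≠ 0 := fun h => hd n (eq_neg_of_add_eq_zero_left h)
    have e2 : d + n + 1 ≠ 0 := fun h => hd (n + 1) (by push_cast; linear_combination h)
    have e3 : e + n ≠ 0 := fun h => he n (eq_neg_of_add_eq_zero_left h)
    have e4 : (n : ℂ) + 1 ≠ 0 := by exact_mod_cast n.succ_ne_zero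
    have h1 : hypTerm a b (c + 1) (d + 2) e n =
        hypTerm a b c d e n * ((c + n) * (d * (d + 1))) / (c * ((d + n) * (d + n + 1))) := by
      rw [← hypTerm_shift a b c hd, mul_div_cancel_right₀ _ (by positivity)]
    have hb : b = 1 - a := by linear_combination hab
    have hee : e = 1 + 2 * c - d := by linear_combination hde
    simp only [hg, hypTerm_succ, h1]
    push_cast
    rw [← add_assoc d]
    field_simp
    subst hb hee
    ring
  have hlim : Tendsto g atTop (𝓝 0) := by
    have t1 : Tendsto (fun n : ℕ => d * (d + 1) * (e + n - 1) / (c * (d + n))) atTop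
        (𝓝 (d * (d + 1) / c)) := by
      have i1 : Tendsto (fun n : ℕ => (d + n : ℂ)⁻¹) atTop (𝓝 0) := by
        refine tendsto_inv₀_cobounded.comp ?_
        exact (tendsto_const_add_cobounded d).comp tendsto_natCast_atTop_cobounded
      have i2 : Tendsto (fun n : ℕ => d * (d + 1) / c * (1 + (e - 1 - d) * (d + n : ℂ)⁻¹)) atTop
          (𝓝 (d * (d + 1) / c * (1 + (e - 1 - d) * 0))) := (((i1.const_mul _).const_add _).const_mul _)
      rw [mul_zero, add_zero, mul_one] at i2
      refine i2.congr fun n => ?_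
      have e1 : d + n ≠ 0 := fun h => hd n (eq_neg_of_add_eq_zero_left h)
      field_simp
      ring
    simpa using t1.mul (tendsto_nat_mul_hypTerm a b c hd he s1)
  have hs := ((S2.mul_left ((a + d) * (b + d))).sub (S1.mul_left (d * (d + 1)))).hasSum.tendsto_sum_nat
  simp_rw [← hstep, Finset.sum_range_sub] at hs
  have h0 : g 0 = 0 := by simp [hg]
  rw [h0] at hs
  simp only [sub_zero] at hs
  have := tendsto_nhds_unique hs hlim
  simp_rw [hstep] at this
  rw [(S2.mul_left _).tsum_sub (S1.mul_left _), tsum_mul_left, tsum_mul_left] at this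
  linear_combination -this

lemma norm_hypTerm_succ_le (a b c d e : ℂ) {M : ℕ} (hM : ‖c‖ + ‖d‖ + ‖e‖ < M) (k : ℕ) :
    ‖hypTerm a b (c + M) (d + M) (e + M) (k + 1)‖ ≤ ‖hypTerm a b (c + M) (d + M) (e + M) k‖ *
      ((k + (‖a‖ + ‖b‖)) ^ 2 / ((k + 1) * (M + k - (‖c‖ + ‖d‖ + ‖e‖)))) := by
  rw [hypTerm_succ, norm_mul]
  refine mul_le_mul_of_nonneg_left ?_ (norm_nonneg _)
  have hkM : ∀ z : ℂ, ‖z + M + k‖ ≤ M + k + ‖z‖ := fun z => by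
    calc ‖z + M + k‖ ≤ ‖z‖ + ‖(M : ℂ)‖ + ‖(k : ℂ)‖ := norm_add₃_le
      _ = M + k + ‖z‖ := by simp only [Complex.norm_natCast]; ring
  have hkM' : ∀ z : ℂ, M + k - ‖z‖ ≤ ‖z + M + k‖ := fun z => by
    have := norm_sub_norm_le ((M + k : ℕ) : ℂ) (-z)
    rw [Complex.norm_natCast, norm_neg, sub_neg_eq_add] at this
    push_cast at this
    rwa [show z + M + k = M + k + z by ring]
  have hk : ∀ z : ℂ, ‖z + k‖ ≤ k + ‖z‖ := fun z => by
    have := norm_add_le z (k : ℂ)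
    rw [Complex.norm_natCast] at this
    linarith
  have hk1 : ‖(k : ℂ) + 1‖ = k + 1 := by
    have := Complex.norm_natCast (k + 1)
    push_cast at this
    exact this
  have hk0 : (0 : ℝ) ≤ k := k.cast_nonneg
  have na := norm_nonneg a
  have nb := norm_nonneg b
  have nc := norm_nonneg c
  have nd := norm_nonneg d
  have ne := norm_nonneg e
  rw [norm_div, norm_mul, norm_mul, norm_mul, norm_mul, hk1]
  have hD : 0 < ‖d + M + k‖ := lt_of_lt_of_le (by linarith) (hkM' d)
  have hE : 0 < ‖e + M + k‖ := lt_of_lt_of_le (by linarith) (hkM' e)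
  rw [div_le_div_iff₀ (by positivity) (mul_pos (by linarith) (by linarith))]
  have h1 : ‖a + k‖ * ‖b + k‖ ≤ (k + (‖a‖ + ‖b‖)) ^ 2 := by
    rw [sq]
    exact mul_le_mul ((hk a).trans (by linarith)) ((hk b).trans (by linarith)) (norm_nonneg _)
      (by linarith)
  have h2 : ‖c + M + k‖ * (M + k - (‖c‖ + ‖d‖ + ‖e‖)) ≤ ‖d + M + k‖ * ‖e + M + k‖ :=
    calc ‖c + M + k‖ * (M + k - (‖c‖ + ‖d‖ + ‖e‖))
        ≤ (M + k + ‖c‖) * (M + k - (‖c‖ + ‖d‖ + ‖e‖)) :=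
          mul_le_mul_of_nonneg_right (hkM c) (by linarith)
      _ ≤ (M + k - ‖d‖) * (M + k - ‖e‖) := by
          nlinarith [mul_nonneg nc nc, mul_nonneg nc nd, mul_nonneg nc ne, mul_nonneg nd ne]
      _ ≤ ‖d + M + k‖ * ‖e + M + k‖ :=
          mul_le_mul (hkM' d) (hkM' e) (by linarith) (norm_nonneg _)
  calc ‖a + k‖ * ‖b + k‖ * ‖c + M + k‖ * ((k + 1) * (M + k - (‖c‖ + ‖d‖ + ‖e‖)))
      = (‖a + k‖ * ‖b + k‖) * (‖c + M + k‖ * (M + k - (‖c‖ + ‖d‖ + ‖e‖))) * (k + 1) := by ring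
    _ ≤ (k + (‖a‖ + ‖b‖)) ^ 2 * (‖d + M + k‖ * ‖e + M + k‖) * (k + 1) := by
        refine mul_le_mul_of_nonneg_right ?_ (by linarith)
        exact mul_le_mul h1 h2 (mul_nonneg (norm_nonneg _) (by linarith)) (by positivity)
    _ = (k + (‖a‖ + ‖b‖)) ^ 2 * (‖d + M + k‖ * ‖e + M + k‖ * (k + 1)) := by ring

lemma eventually_norm_hypTerm_le (a b c d e : ℂ) :
    ∀ᶠ M : ℕ in atTop, ∀ k, ‖hypTerm a b (c + M) (d + M) (e + M) k‖ ≤ 1 / ((k : ℝ) + 1) ^ 2 := by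
  set A := ‖a‖ + ‖b‖ with hA
  have hA0 : 0 ≤ A := by positivity
  filter_upwards [tendsto_natCast_atTop_atTop.eventually_ge_atTop
    (1 + (‖c‖ + ‖d‖ + ‖e‖) + (2 * (2 * A + 1) + (2 * A + 1) ^ 2))] with M hM k
  have hM' : ‖c‖ + ‖d‖ + ‖e‖ < M := by nlinarith
  induction k with
  | zero => simp [hypTerm_zero]
  | succ k ih =>
    refine (norm_hypTerm_succ_le a b c d e hM' k).trans ?_
    have hk0 : (0 : ℝ) ≤ k := k.cast_nonneg
    have hden : (0 : ℝ) < M + k - (‖c‖ + ‖d‖ + ‖e‖) := by linarith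
    refine (mul_le_mul_of_nonneg_right ih (by positivity)).trans ?_
    rw [← hA, div_mul_div_comm, one_mul, div_le_div_iff₀ (by positivity) (by positivity), one_mul]
    push_cast
    set y : ℝ := k + 1 with hy
    have hy1 : 1 ≤ y := by linarith
    have hk : (k : ℝ) = y - 1 := by linarith
    have h1 : (k + A) * (y + 1) ≤ y ^ 2 + (2 * A + 1) * y := by rw [hk]; nlinarith
    have h2 : ((k + A) * (y + 1)) ^ 2 ≤ (y ^ 2 + (2 * A + 1) * y) ^ 2 :=
      pow_le_pow_left₀ (by positivity) h1 2
    have h3 : (y ^ 2 + (2 * A + 1) * y) ^ 2 ≤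
        y ^ 3 * (y + (2 * (2 * A + 1) + (2 * A + 1) ^ 2)) := by
      have : 0 ≤ (2 * A + 1) ^ 2 * y ^ 2 * (y - 1) := mul_nonneg (by positivity) (by linarith)
      nlinarith
    have h4 : y ^ 3 * (y + (2 * (2 * A + 1) + (2 * A + 1) ^ 2)) ≤
        y ^ 3 * (M + k - (‖c‖ + ‖d‖ + ‖e‖)) :=
      mul_le_mul_of_nonneg_left (by linarith) (by positivity)
    calc (k + A) ^ 2 * (y + 1) ^ 2 = ((k + A) * (y + 1)) ^ 2 := by ring
      _ ≤ y ^ 3 * (M + k - (‖c‖ + ‖d‖ + ‖e‖)) := h2.trans (h3.trans h4)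
      _ = y ^ 2 * (y * (M + k - (‖c‖ + ‖d‖ + ‖e‖))) := by ring

lemma tendsto_tsum_hypTerm_add (a b c d e : ℂ) :
    Tendsto (fun M : ℕ => ∑' k, hypTerm a b (c + M) (d + M) (e + M) k) atTop (𝓝 1) := by
  have hev := eventually_norm_hypTerm_le a b c d e
  have hlim : ∀ k, Tendsto (fun M : ℕ => hypTerm a b (c + M) (d + M) (e + M) k) atTop
      (𝓝 (if k = 0 then 1 else 0)) := by
    rintro (_ | k)
    · simp [hypTerm_zero]
    · simp only [Nat.add_eq_zero_iff, one_ne_zero, and_false, if_false]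
      have h0 : Tendsto (fun M : ℕ => (k + (‖a‖ + ‖b‖)) ^ 2 /
          ((k + 1) * ((M : ℝ) + k - (‖c‖ + ‖d‖ + ‖e‖)))) atTop (𝓝 0) := by
        refine Tendsto.div_atTop tendsto_const_nhds ?_
        refine Tendsto.const_mul_atTop (by positivity) ?_
        simp_rw [add_sub_assoc]
        exact tendsto_atTop_add_const_right _ _ tendsto_natCast_atTop_atTop
      refine squeeze_zero_norm' ?_ h0
      filter_upwards [hev, tendsto_natCast_atTop_atTop.eventually_gt_atTop
        (‖c‖ + ‖d‖ + ‖e‖)] with M hM hM'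
      refine (norm_hypTerm_succ_le a b c d e hM' k).trans ?_
      refine mul_le_of_le_one_left ?_ ?_
      · have hk0 : (0 : ℝ) ≤ k := k.cast_nonneg
        have hden : (0 : ℝ) < M + k - (‖c‖ + ‖d‖ + ‖e‖) := by linarith
        positivity
      · refine (hM k).trans ?_
        rw [div_le_one (by positivity)]
        exact one_le_pow₀ (by linarith [k.cast_nonneg (α := ℝ)])
  have hs : Summable fun k : ℕ => 1 / ((k : ℝ) + 1) ^ 2 := by
    have := (summable_nat_add_iff 1).2 (Real.summable_one_div_nat_pow.2 (one_lt_two))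
    simpa using this
  have := tendsto_tsum_of_dominated_convergence hs hlim hev
  rwa [tsum_ite_eq] at this

lemma tendsto_Gamma_ratio_of_re_pos {z w z' w' : ℂ} (hz : 0 < z.re) (hw : 0 < w.re)
    (hz' : 0 < z'.re) (hw' : 0 < w'.re) (h : z + w = z' + w') :
    Tendsto (fun n : ℕ => Gamma (z + n) * Gamma (w + n) *
      (Gamma (z' + n))⁻¹ * (Gamma (w' + n))⁻¹) atTop (𝓝 1) := by
  have key : ∀ {u : ℂ}, 0 < u.re → ∀ n : ℕ, u ≠ -(n : ℂ) := fun {u} hu n h => by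
    rw [h] at hu
    simp at hu
    linarith [n.cast_nonneg (α := ℝ)]
  have lim : ∀ {u : ℂ}, 0 < u.re → Tendsto (fun n => Gamma u / GammaSeq u n) atTop (𝓝 1) :=
    fun {u} hu => by
      have := (tendsto_const_nhds (x := Gamma u)).div (GammaSeq_tendsto_Gamma u)
        (Gamma_ne_zero (key hu))
      rwa [div_self (Gamma_ne_zero (key hu))] at this
  have form : ∀ {u : ℂ}, 0 < u.re → ∀ n : ℕ, n ≠ 0 → Gamma (u + (n + 1 : ℕ)) =
      Gamma u / GammaSeq u n * ((n : ℂ) ^ u * n.factorial) := fun {u} hu n hn => by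
    have h1 := GammaSeq_mul_poch (poch_ne_zero (key hu) (n + 1))
    have hn' : (n : ℂ) ^ u * n.factorial ≠ 0 := by simp [cpow_eq_zero_iff, hn, n.factorial_ne_zero]
    have h : GammaSeq u n ≠ 0 := left_ne_zero_of_mul (h1 ▸ hn')
    rw [← h1, ← poch_mul_Gamma (key hu)]
    field_simp
  rw [← tendsto_add_atTop_iff_nat 1]
  have := (((lim hz).mul (lim hw)).mul ((lim hz').inv₀ one_ne_zero)).mul
    ((lim hw').inv₀ one_ne_zero)
  simp only [mul_one, inv_one] at this
  refine this.congr' ?_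
  filter_upwards [eventually_gt_atTop 0] with n hn
  rw [form hz n hn.ne', form hw n hn.ne', form hz' n hn.ne', form hw' n hn.ne']
  have hn0 : (n : ℂ) ≠ 0 := by exact_mod_cast hn.ne'
  have hf : (n.factorial : ℂ) ≠ 0 := by exact_mod_cast n.factorial_ne_zero
  have hp : (n : ℂ) ^ z * (n : ℂ) ^ w = (n : ℂ) ^ z' * (n : ℂ) ^ w' := by
    rw [← cpow_add _ _ hn0, ← cpow_add _ _ hn0, h]
  have q1 : (n : ℂ) ^ z' ≠ 0 := by simp [cpow_eq_zero_iff, hn0]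
  have q2 : (n : ℂ) ^ w' ≠ 0 := by simp [cpow_eq_zero_iff, hn0]
  have hq : ((n : ℂ) ^ z * n.factorial) * ((n : ℂ) ^ w * n.factorial) *
      ((n : ℂ) ^ z' * n.factorial)⁻¹ * ((n : ℂ) ^ w' * n.factorial)⁻¹ = 1 := by
    field_simp
    exact hp
  simp only [mul_inv] at hq ⊢
  linear_combination (-(Gamma z / GammaSeq z n * (Gamma w / GammaSeq w n) *
    (Gamma z' / GammaSeq z' n)⁻¹ * (Gamma w' / GammaSeq w' n)⁻¹)) * hq

lemma exists_nat_re_add_pos (z : ℂ) : ∃ N : ℕ, ∀ n ≥ N, 0 < (z + n).re := by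
  obtain ⟨N, hN⟩ := exists_nat_gt (-z.re)
  refine ⟨N, fun n hn => ?_⟩
  have : (N : ℝ) ≤ n := by exact_mod_cast hn
  simp
  linarith

lemma tendsto_Gamma_ratio {z w z' w' : ℂ} (h : z + w = z' + w') :
    Tendsto (fun n : ℕ => Gamma (z + n) * Gamma (w + n) *
      (Gamma (z' + n))⁻¹ * (Gamma (w' + n))⁻¹) atTop (𝓝 1) := by
  obtain ⟨N₁, h₁⟩ := exists_nat_re_add_pos z
  obtain ⟨N₂, h₂⟩ := exists_nat_re_add_pos w
  obtain ⟨N₃, h₃⟩ := exists_nat_re_add_pos z'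
  obtain ⟨N₄, h₄⟩ := exists_nat_re_add_pos w'
  set N := N₁ + N₂ + N₃ + N₄
  rw [← tendsto_add_atTop_iff_nat N]
  have := tendsto_Gamma_ratio_of_re_pos (h₁ N (by omega)) (h₂ N (by omega)) (h₃ N (by omega))
    (h₄ N (by omega)) (by linear_combination h)
  refine this.congr fun n => ?_
  push_cast
  simp only [add_assoc, add_comm (N : ℂ)]

/-- The closed form in Whipple's theorem. -/
noncomputable def whippleValue (a b c d e : ℂ) : ℂ :=
  (Real.pi : ℂ) * 2 ^ (1 - 2 * c) * Gamma d * Gamma e * (Gamma ((a + d) / 2))⁻¹ *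
    (Gamma ((a + e) / 2))⁻¹ * (Gamma ((b + d) / 2))⁻¹ * (Gamma ((b + e) / 2))⁻¹

lemma whippleValue_swap (a b c d e : ℂ) : whippleValue a b c d e = whippleValue a b c e d := by
  unfold whippleValue
  ring

lemma whippleValue_shift (a b c : ℂ) {d : ℂ} (hd : ∀ n : ℕ, d ≠ -(n : ℂ)) (e : ℂ) :
    d * (d + 1) * whippleValue a b c d e =
      (a + d) * (b + d) * whippleValue a b (c + 1) (d + 2) e := by
  have h0 : d ≠ 0 := by simpa using hd 0
  have h1 : d + 1 ≠ 0 := fun h => hd 1 (by push_cast; linear_combination h)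
  have hG : Gamma (d + 2) = (d + 1) * (d * Gamma d) := by
    rw [← Gamma_add_one d h0, ← Gamma_add_one _ h1]
    ring_nf
  have e1 := one_div_Gamma_eq_self_mul_one_div_Gamma_add_one ((a + d) / 2)
  have e2 := one_div_Gamma_eq_self_mul_one_div_Gamma_add_one ((b + d) / 2)
  have hp : (2 : ℂ) ^ (1 - 2 * c) = 4 * 2 ^ (1 - 2 * (c + 1)) := by
    rw [show (1 : ℂ) - 2 * c = (1 - 2 * (c + 1)) + (2 : ℕ) by push_cast; ring,
      cpow_add _ _ two_ne_zero, cpow_natCast]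
    ring
  unfold whippleValue
  rw [e1, e2, hp, hG, show (a + (d + 2)) / 2 = (a + d) / 2 + 1 by ring,
    show (b + (d + 2)) / 2 = (b + d) / 2 + 1 by ring]
  ring

lemma tendsto_whippleValue {a b c d e : ℂ} (hab : a + b = 1) (hde : d + e = 1 + 2 * c) :
    Tendsto (fun N : ℕ => whippleValue a b (c + 2 * N) (d + 2 * N) (e + 2 * N)) atTop (𝓝 1) := by
  have hd := tendsto_Gamma_ratio (z := d / 2) (w := d / 2 + 1 / 2) (z' := (a + d) / 2)
    (w' := (b + d) / 2) (by linear_combination -hab / 2)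
  have he := tendsto_Gamma_ratio (z := e / 2) (w := e / 2 + 1 / 2) (z' := (a + e) / 2)
    (w' := (b + e) / 2) (by linear_combination -hab / 2)
  have := hd.mul he
  rw [mul_one] at this
  refine this.congr fun N => ?_
  have dup : ∀ z : ℂ, Gamma (z / 2 + N) * Gamma (z / 2 + 1 / 2 + N) =
      Gamma (z + 2 * N) * 2 ^ (1 - (z + 2 * N)) * ((√Real.pi : ℝ) : ℂ) := fun z => by
    have := Complex.Gamma_mul_Gamma_add_half (z / 2 + N)
    rw [show 2 * (z / 2 + (N : ℂ)) = z + 2 * N by ring] at this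
    rw [← this]
    ring_nf
  have hpi : ((√Real.pi : ℝ) : ℂ) * ((√Real.pi : ℝ) : ℂ) = Real.pi := by
    rw [← ofReal_mul, Real.mul_self_sqrt Real.pi_pos.le]
  have hpow : (2 : ℂ) ^ (1 - (d + 2 * N)) * 2 ^ (1 - (e + 2 * N)) = 2 ^ (1 - 2 * (c + 2 * N)) := by
    rw [← cpow_add _ _ two_ne_zero]
    congr 1
    linear_combination -hde
  rw [dup, dup, whippleValue, ← hpi, ← hpow]
  simp only [show ∀ x y : ℂ, (x + (y + 2 * N)) / 2 = (x + y) / 2 + N from fun x y => by ring]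
  ring

/-- **Whipple's theorem** for `₃F₂(1)`. -/
theorem tsum_hypTerm_eq_whippleValue {a b c d e : ℂ} (hc : 0 < c.re) (hab : a + b = 1)
    (hde : d + e = 1 + 2 * c) (hd : ∀ n : ℕ, d ≠ -(n : ℂ)) (he : ∀ n : ℕ, e ≠ -(n : ℂ)) :
    ∑' n, hypTerm a b c d e n = whippleValue a b c d e := by
  have hne : ∀ {u : ℂ}, (∀ n : ℕ, u ≠ -(n : ℂ)) → ∀ (m n : ℕ), u + m ≠ -(n : ℂ) :=
    fun {u} hu m n h => hu (n + m) (by push_cast; linear_combination h)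
  have hP : ∀ N : ℕ, ∃ p : ℂ,
      ∑' n, hypTerm a b c d e n =
        p * ∑' n, hypTerm a b (c + 2 * N) (d + 2 * N) (e + 2 * N) n ∧
      whippleValue a b c d e = p * whippleValue a b (c + 2 * N) (d + 2 * N) (e + 2 * N) := by
    intro N
    induction N with
    | zero => exact ⟨1, by simp, by simp⟩
    | succ N ih =>
      obtain ⟨p, h1, h2⟩ := ih
      set c' := c + 2 * N with hc'
      set d' := d + 2 * N with hd'
      set e' := e + 2 * N with he'
      have hcre : 0 < c'.re := by simp [hc']; positivity
      have hcre1 : 0 < (c' + 1).re := by simp; positivity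
      have hde1 : d' + e' = 1 + 2 * c' := by rw [hc', hd', he']; linear_combination hde
      have hde2 : e' + (d' + 2) = 1 + 2 * (c' + 1) := by linear_combination hde1
      have nd : ∀ n : ℕ, d' ≠ -(n : ℂ) := by simpa using hne hd (2 * N)
      have ne : ∀ n : ℕ, e' ≠ -(n : ℂ) := by simpa using hne he (2 * N)
      have nd2 : ∀ n : ℕ, d' + 2 ≠ -(n : ℂ) := by simpa using hne nd 2
      have d0 : d' * (d' + 1) ≠ 0 :=
        mul_ne_zero (by simpa using nd 0) fun h => nd 1 (by push_cast; linear_combination h)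
      have e0 : e' * (e' + 1) ≠ 0 :=
        mul_ne_zero (by simpa using ne 0) fun h => ne 1 (by push_cast; linear_combination h)
      have s1 := tsum_hypTerm_shift hcre hab hde1 nd ne
      have s2 := tsum_hypTerm_shift hcre1 hab hde2 ne nd2
      have w1 := whippleValue_shift a b c' nd e'
      have w2 := whippleValue_shift a b (c' + 1) ne (d' + 2)
      rw [hypTerm_swap a b (c' + 1), hypTerm_swap a b (c' + 1 + 1)] at s2
      rw [whippleValue_swap a b (c' + 1), whippleValue_swap a b (c' + 1 + 1)] at w2
      refine ⟨p * ((a + d') * (b + d') / (d' * (d' + 1))) *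
        ((a + e') * (b + e') / (e' * (e' + 1))), ?_, ?_⟩ <;>
      rw [show c + 2 * ((N + 1 : ℕ) : ℂ) = c' + 1 + 1 by push_cast; ring,
        show d + 2 * ((N + 1 : ℕ) : ℂ) = d' + 2 by push_cast; ring,
        show e + 2 * ((N + 1 : ℕ) : ℂ) = e' + 2 by push_cast; ring]
      · rw [h1, mul_assoc, mul_assoc, div_mul_eq_mul_div _ _ (∑' n, _), ← s2,
          mul_div_cancel_left₀ _ e0, div_mul_eq_mul_div, ← s1, mul_div_cancel_left₀ _ d0]
      · rw [h2, mul_assoc, mul_assoc, div_mul_eq_mul_div _ _ (whippleValue _ _ _ _ _), ← w2,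
          mul_div_cancel_left₀ _ e0, div_mul_eq_mul_div, ← w1, mul_div_cancel_left₀ _ d0]
  have hS : Tendsto (fun N : ℕ => ∑' n, hypTerm a b (c + 2 * N) (d + 2 * N) (e + 2 * N) n) atTop
      (𝓝 1) := by
    have := (tendsto_tsum_hypTerm_add a b c d e).comp
      (tendsto_id.const_mul_atTop' (two_pos : 0 < 2))
    refine this.congr fun N => ?_
    simp
  have hQ := tendsto_whippleValue (c := c) hab hde
  have t1 := hS.const_mul (whippleValue a b c d e)
  have t2 := hQ.const_mul (∑' n, hypTerm a b c d e n)
  rw [mul_one] at t1 t2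
  refine tendsto_nhds_unique t2 (t1.congr fun N => ?_)
  obtain ⟨p, h1, h2⟩ := hP N
  rw [h1, h2]
  ring

/-! ### Laplace transforms along complex rays -/

lemma norm_exp_mul_cpow (c s : ℂ) {t : ℝ} (ht : 0 < t) :
    ‖exp (-(s * t)) * (t : ℂ) ^ (c - 1)‖ = t ^ (c.re - 1) * Real.exp (-(s.re * t)) := by
  rw [norm_mul, norm_exp, norm_cpow_eq_rpow_re_of_pos ht, mul_comm]
  simp

lemma integrableOn_rpow_mul_exp_neg_mul {γ σ : ℝ} (hγ : 0 < γ) (hσ : 0 < σ) :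
    IntegrableOn (fun t : ℝ => t ^ (γ - 1) * Real.exp (-(σ * t))) (Ioi 0) := by
  simpa using integrableOn_rpow_mul_exp_neg_mul_rpow (s := γ - 1) (by linarith) one_pos hσ

lemma measurable_exp_mul_cpow (c s : ℂ) :
    Measurable fun t : ℝ => exp (-(s * t)) * (t : ℂ) ^ (c - 1) := by fun_prop

lemma integrableOn_exp_mul_cpow {c s : ℂ} (hc : 0 < c.re) (hs : 0 < s.re) :
    IntegrableOn (fun t : ℝ => exp (-(s * t)) * (t : ℂ) ^ (c - 1)) (Ioi 0) := by
  refine (integrableOn_rpow_mul_exp_neg_mul hc hs).mono'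
    (measurable_exp_mul_cpow c s).aestronglyMeasurable ?_
  filter_upwards [ae_restrict_mem measurableSet_Ioi] with t ht
  exact (norm_exp_mul_cpow c s ht).le

lemma differentiableAt_integral_exp_mul_cpow {c s : ℂ} (hc : 0 < c.re) (hs : 0 < s.re) :
    DifferentiableAt ℂ (fun s : ℂ => ∫ t in Ioi (0 : ℝ), exp (-(s * t)) * (t : ℂ) ^ (c - 1)) s := by
  have hU : {z : ℂ | s.re / 2 < z.re} ∈ 𝓝 s :=
    (isOpen_lt continuous_const continuous_re).mem_nhds (by simp; linarith)
  refine (hasDerivAt_integral_of_dominated_loc_of_deriv_le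
    (F' := fun (z : ℂ) (t : ℝ) => -(t : ℂ) * (exp (-(z * t)) * (t : ℂ) ^ (c - 1)))
    (bound := fun t => t ^ (c.re + 1 - 1) * Real.exp (-(s.re / 2 * t))) hU
    (Eventually.of_forall fun z => (measurable_exp_mul_cpow c z).aestronglyMeasurable)
    (integrableOn_exp_mul_cpow hc hs) (by fun_prop) ?_
    (integrableOn_rpow_mul_exp_neg_mul (by linarith) (by linarith)) ?_).2.differentiableAt
  · filter_upwards [ae_restrict_mem measurableSet_Ioi] with t ht z hz
    have ht : 0 < t := ht
    have hz : s.re / 2 < z.re := hz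
    rw [norm_mul, norm_exp_mul_cpow c z ht, norm_neg, norm_real, Real.norm_of_nonneg ht.le,
      add_sub_right_comm, Real.rpow_add_one ht.ne']
    have : Real.exp (-(z.re * t)) ≤ Real.exp (-(s.re / 2 * t)) := by
      gcongr
    have h0 := Real.rpow_nonneg ht.le (c.re - 1)
    nlinarith [mul_le_mul_of_nonneg_left this (mul_nonneg h0 ht.le)]
  · filter_upwards with t z _
    have : HasDerivAt (fun z : ℂ => -(z * t)) (-(t : ℂ)) z :=
      (hasDerivAt_mul_const (t : ℂ)).fun_neg
    rw [← mul_assoc, mul_comm (-(t : ℂ))]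
    exact this.cexp.mul_const _

lemma integral_exp_mul_cpow {c s : ℂ} (hc : 0 < c.re) (hs : 0 < s.re) :
    ∫ t in Ioi (0 : ℝ), exp (-(s * t)) * (t : ℂ) ^ (c - 1) = s ^ (-c) * Gamma c := by
  have hopen : IsOpen {z : ℂ | 0 < z.re} := isOpen_lt continuous_const continuous_re
  have hconv : IsPreconnected {z : ℂ | 0 < z.re} := (convex_halfSpace_re_gt 0).isPreconnected
  have h1 : AnalyticOnNhd ℂ
      (fun s : ℂ => ∫ t in Ioi (0 : ℝ), exp (-(s * t)) * (t : ℂ) ^ (c - 1)) {z : ℂ | 0 < z.re} :=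
    DifferentiableOn.analyticOnNhd
      (fun z hz => (differentiableAt_integral_exp_mul_cpow hc hz).differentiableWithinAt) hopen
  have h2 : AnalyticOnNhd ℂ (fun s : ℂ => s ^ (-c) * Gamma c) {z : ℂ | 0 < z.re} := by
    refine DifferentiableOn.analyticOnNhd (fun z hz => ?_) hopen
    have hz : z ∈ slitPlane := Or.inl hz
    exact ((differentiableAt_id.cpow_const hz).mul_const _).differentiableWithinAt
  have hreal : ∀ r : ℝ, 0 < r → ∫ t in Ioi (0 : ℝ), exp (-((r : ℂ) * t)) * (t : ℂ) ^ (c - 1) =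
      (r : ℂ) ^ (-c) * Gamma c := fun r hr => by
    have := integral_cpow_mul_exp_neg_mul_Ioi hc hr
    rw [one_div, inv_cpow _ _ (by rw [arg_ofReal_of_nonneg hr.le]; exact Real.pi_pos.ne),
      ← cpow_neg] at this
    rw [← this]
    simp_rw [mul_comm]
  refine h1.eqOn_of_preconnected_of_frequently_eq h2 hconv (z₀ := 1) (by simp) ?_ hs
  have ht : Tendsto (fun n : ℕ => ((1 + 1 / ((n : ℝ) + 1) : ℝ) : ℂ)) atTop (𝓝[≠] 1) := by
    refine tendsto_nhdsWithin_iff.2 ⟨?_, Eventually.of_forall fun n => ?_⟩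
    · have := (tendsto_one_div_add_atTop_nhds_zero_nat (𝕜 := ℝ)).const_add 1
      rw [add_zero] at this
      exact (continuous_ofReal.tendsto' _ _ (by simp)).comp this
    · have : (0 : ℝ) < 1 / ((n : ℝ) + 1) := by positivity
      rw [mem_compl_iff, mem_singleton_iff, ofReal_eq_one]
      linarith
  exact ht.frequently (Frequently.of_forall fun n => hreal _ (by positivity))

/-- The function `f` has, along every ray in the right half-plane, an absolutely convergent
Laplace-type integral with weight `t ^ (c - 1)`, and its value depends on the ray only through
the factor `s ^ (-c)`. -/
def HasRayIntegral (f : ℂ → ℂ) (c : ℂ) : Prop :=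
  ∃ V : ℂ, ∀ s : ℂ, 0 < s.re →
    IntegrableOn (fun t : ℝ => exp (-(s * t)) * (t : ℂ) ^ (c - 1) * f (s * t)) (Ioi 0) ∧
    ∫ t in Ioi (0 : ℝ), exp (-(s * t)) * (t : ℂ) ^ (c - 1) * f (s * t) = s ^ (-c) * V

namespace HasRayIntegral

variable {f g : ℂ → ℂ} {c : ℂ}

lemma add (hf : HasRayIntegral f c) (hg : HasRayIntegral g c) :
    HasRayIntegral (fun u => f u + g u) c := by
  obtain ⟨V, hV⟩ := hf
  obtain ⟨W, hW⟩ := hg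
  refine ⟨V + W, fun s hs => ?_⟩
  simp_rw [mul_add]
  rw [integral_add (hV s hs).1 (hW s hs).1, (hV s hs).2, (hW s hs).2]
  exact ⟨(hV s hs).1.add (hW s hs).1, rfl⟩

lemma const_mul (k : ℂ) (hf : HasRayIntegral f c) : HasRayIntegral (fun u => k * f u) c := by
  obtain ⟨V, hV⟩ := hf
  refine ⟨k * V, fun s hs => ?_⟩
  simp_rw [mul_left_comm _ k]
  rw [integral_const_mul, (hV s hs).2]
  exact ⟨(hV s hs).1.const_mul k, rfl⟩

lemma pow_mul (n : ℕ) (hf : HasRayIntegral f (c + n)) :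
    HasRayIntegral (fun u => u ^ n * f u) c := by
  obtain ⟨V, hV⟩ := hf
  refine ⟨V, fun s hs => ?_⟩
  have hs0 : s ≠ 0 := by rintro rfl; simp at hs
  have hcongr : EqOn (fun t : ℝ => s ^ n * (exp (-(s * t)) * (t : ℂ) ^ (c + n - 1) * f (s * t)))
      (fun t : ℝ => exp (-(s * t)) * (t : ℂ) ^ (c - 1) * ((s * t) ^ n * f (s * t))) (Ioi 0) := by
    intro t ht
    have ht0 : (t : ℂ) ≠ 0 := by exact_mod_cast (ne_of_gt ht)
    simp only
    rw [add_sub_right_comm, cpow_add _ _ ht0, cpow_natCast]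
    ring
  refine ⟨IntegrableOn.congr_fun (Integrable.const_mul (hV s hs).1 (s ^ n)) hcongr
    measurableSet_Ioi, ?_⟩
  rw [← setIntegral_congr_fun measurableSet_Ioi hcongr, integral_const_mul, (hV s hs).2, neg_add,
    cpow_add _ _ hs0, cpow_neg s n, cpow_natCast]
  field_simp

lemma one (hc : 0 < c.re) : HasRayIntegral (fun _ => 1) c :=
  ⟨Gamma c, fun s hs => by
    simp_rw [mul_one]
    exact ⟨integrableOn_exp_mul_cpow hc hs, integral_exp_mul_cpow hc hs⟩⟩

lemma zero : HasRayIntegral (fun _ => 0) c := ⟨0, fun s _ => by simp⟩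

lemma polynomial (hc : 0 < c.re) (p : ℕ → ℂ) (N : ℕ) :
    HasRayIntegral (fun u => ∑ n ∈ Finset.range N, p n * u ^ n) c := by
  induction N with
  | zero => simpa using zero
  | succ N ih =>
    simp_rw [Finset.sum_range_succ]
    refine ih.add (const_mul _ ?_)
    have h1 : 0 < (c + N).re := by simp; positivity
    simpa using pow_mul N (one h1)

end HasRayIntegral

lemma mul_ofReal_cpow (s c : ℂ) (hs : s ≠ 0) {r : ℝ} (hr : 0 < r) :
    (s * r) ^ c = s ^ c * (r : ℂ) ^ c := by
  have hr0 : (r : ℂ) ≠ 0 := by exact_mod_cast hr.ne'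
  rw [cpow_def_of_ne_zero (mul_ne_zero hs hr0), cpow_def_of_ne_zero hs, cpow_def_of_ne_zero hr0,
    mul_comm s, log_ofReal_mul hr hs, ← exp_add, ofReal_log hr.le]
  ring_nf

lemma hasRayIntegral_integral_exp {Ω : Type*} [MeasurableSpace Ω] {μ : Measure Ω} [SFinite μ]
    {X : Ω → ℝ} {w : Ω → ℂ} {c : ℂ} (hX : Measurable X) (hw : Measurable w)
    (hX1 : ∀ᵐ ω ∂μ, X ω < 1) (hc : 0 < c.re)
    (hint : Integrable (fun ω => (1 - X ω) ^ (-c.re) * ‖w ω‖) μ) :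
    HasRayIntegral (fun u => ∫ ω, exp (u * X ω) * w ω ∂μ) c := by
  refine ⟨∫ ω, ((1 - X ω : ℝ) : ℂ) ^ (-c) * Gamma c * w ω ∂μ, fun s hs => ?_⟩
  have hs0 : s ≠ 0 := by rintro rfl; simp at hs
  set G : Ω → ℝ → ℂ := fun ω t =>
    exp (-(s * (1 - X ω : ℝ) * t)) * (t : ℂ) ^ (c - 1) * w ω with hG
  have hmeas : AEStronglyMeasurable (Function.uncurry G) (μ.prod (volume.restrict (Ioi 0))) := by
    refine Measurable.aestronglyMeasurable ?_
    simp only [hG, Function.uncurry_def]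
    fun_prop
  have hre : ∀ ω, X ω < 1 → 0 < (s * (1 - X ω : ℝ)).re := fun ω h => by
    rw [re_mul_ofReal]
    exact mul_pos hs (by linarith)
  have hGint : Integrable (Function.uncurry G) (μ.prod (volume.restrict (Ioi 0))) := by
    rw [integrable_prod_iff hmeas]
    constructor
    · filter_upwards [hX1] with ω hω
      exact (integrableOn_exp_mul_cpow hc (hre ω hω)).mul_const (w ω)
    · refine (hint.const_mul (s.re ^ (-c.re) * Real.Gamma c.re)).congr ?_
      filter_upwards [hX1] with ω hω
      have h1 : ∫ t in Ioi (0 : ℝ), ‖Function.uncurry G (ω, t)‖ =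
          ∫ t in Ioi (0 : ℝ), t ^ (c.re - 1) *
            Real.exp (-((s * (1 - X ω : ℝ)).re * t)) * ‖w ω‖ := by
        refine setIntegral_congr_fun measurableSet_Ioi fun t ht => ?_
        simp only [hG, Function.uncurry_apply_pair]
        rw [norm_mul, norm_exp_mul_cpow _ _ ht]
      rw [h1, integral_mul_const, Real.integral_rpow_mul_exp_neg_mul_Ioi hc (hre ω hω),
        re_mul_ofReal, one_div, Real.inv_rpow (mul_pos hs (by linarith)).le,
        ← Real.rpow_neg (mul_pos hs (by linarith)).le, Real.mul_rpow hs.le (by linarith)]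
      ring
  have hinner : ∀ t : ℝ, ∫ ω, G ω t ∂μ =
      exp (-(s * t)) * (t : ℂ) ^ (c - 1) * ∫ ω, exp (s * t * X ω) * w ω ∂μ := fun t => by
    rw [← integral_const_mul]
    refine integral_congr_ae (Eventually.of_forall fun ω => ?_)
    simp only [hG]
    rw [show -(s * ((1 - X ω : ℝ) : ℂ) * t) = -(s * t) + s * t * X ω by push_cast; ring, exp_add]
    ring
  constructor
  · have := hGint.integral_prod_right
    simp only [Function.uncurry_apply_pair, hinner] at this
    exact this
  · simp_rw [← hinner]
    rw [← integral_integral_swap hGint, ← integral_const_mul]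
    refine integral_congr_ae ?_
    filter_upwards [hX1] with ω hω
    simp only [hG]
    rw [integral_mul_const, integral_exp_mul_cpow hc (hre ω hω),
      mul_ofReal_cpow s _ hs0 (by linarith)]
    ring

lemma hasSum_integral_pow_mul {Ω : Type*} [MeasurableSpace Ω] {μ : Measure Ω}
    {X : Ω → ℝ} {w : Ω → ℂ} (hX : Measurable X) (hX1 : ∀ᵐ ω ∂μ, |X ω| ≤ 1)
    (hint : Integrable w μ) (u : ℂ) :
    HasSum (fun n : ℕ => (∫ ω, (X ω : ℂ) ^ n * w ω ∂μ) * (u ^ n / n.factorial))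
      (∫ ω, exp (u * X ω) * w ω ∂μ) := by
  have hF : ∀ n : ℕ, Integrable (fun ω => (u * X ω) ^ n / n.factorial * w ω) μ := fun n => by
    refine hint.bdd_mul (c := ‖u‖ ^ n / n.factorial) (by fun_prop) ?_
    filter_upwards [hX1] with ω hω
    rw [norm_div, norm_pow, norm_mul, norm_real, Complex.norm_natCast, Real.norm_eq_abs]
    gcongr
    exact mul_le_of_le_one_right (norm_nonneg _) hω
  have hsum : Summable fun n : ℕ => ∫ ω, ‖(u * X ω) ^ n / n.factorial * w ω‖ ∂μ := by
    refine Summable.of_nonneg_of_le (fun n => integral_nonneg fun _ => norm_nonneg _)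
      (fun n => ?_) ((Real.summable_pow_div_factorial ‖u‖).mul_right (∫ ω, ‖w ω‖ ∂μ))
    rw [← integral_const_mul]
    refine integral_mono_ae (hF n).norm (hint.norm.const_mul _) ?_
    filter_upwards [hX1] with ω hω
    rw [norm_mul, norm_div, norm_pow, norm_mul, norm_real, Complex.norm_natCast, Real.norm_eq_abs]
    gcongr
    exact mul_le_of_le_one_right (norm_nonneg _) hω
  have := hasSum_integral_of_summable_integral_norm hF hsum
  have he : ∀ ω, ∑' n : ℕ, (u * X ω) ^ n / n.factorial * w ω = exp (u * X ω) * w ω := fun ω => by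
    rw [tsum_mul_right, exp_eq_exp_ℂ, NormedSpace.exp_eq_tsum_div]
  simp_rw [he] at this
  refine this.congr_fun fun n => ?_
  rw [← integral_mul_const]
  refine integral_congr_ae (Eventually.of_forall fun ω => ?_)
  simp only [mul_pow]
  ring

/-! ### Beta products and quotients of Gamma values -/

/-- The density `x ^ (a - 1) * (1 - x) ^ (p - 1)` of the Beta integral. -/
noncomputable def betaWeight (a p : ℂ) (x : ℝ) : ℂ := (x : ℂ) ^ (a - 1) * (1 - (x : ℂ)) ^ (p - 1)

lemma measurable_betaWeight (a p : ℂ) : Measurable (betaWeight a p) := by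
  unfold betaWeight
  fun_prop

lemma integrableOn_betaWeight {a p : ℂ} (ha : 0 < a.re) (hp : 0 < p.re) :
    IntegrableOn (betaWeight a p) (Ioo 0 1) := by
  have := betaIntegral_convergent ha hp
  rw [intervalIntegrable_iff_integrableOn_Ioo_of_le zero_le_one] at this
  exact this

lemma norm_betaWeight (a p : ℂ) {x : ℝ} (hx : x ∈ Ioo (0 : ℝ) 1) :
    ‖betaWeight a p x‖ = x ^ (a.re - 1) * (1 - x) ^ (p.re - 1) := by
  have h1 : (1 - (x : ℂ)) = ((1 - x : ℝ) : ℂ) := by push_cast; rfl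
  rw [betaWeight, h1, norm_mul, norm_cpow_eq_rpow_re_of_pos hx.1,
    norm_cpow_eq_rpow_re_of_pos (sub_pos.2 hx.2)]
  simp

lemma integrableOn_rpow_mul_norm_betaWeight {a p : ℂ} {η : ℝ} (ha : 0 < a.re) (hp : η < p.re) :
    IntegrableOn (fun x => (1 - x) ^ (-η) * ‖betaWeight a p x‖) (Ioo 0 1) := by
  have h : 0 < (p - η).re := by simp; linarith
  refine IntegrableOn.congr_fun (Integrable.norm (integrableOn_betaWeight ha h))
    (fun x hx => ?_) measurableSet_Ioo
  rw [norm_betaWeight _ _ hx, norm_betaWeight _ _ hx, mul_left_comm,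
    ← Real.rpow_add (sub_pos.2 hx.2)]
  congr 2
  simp
  ring

lemma integral_pow_mul_betaWeight {a p : ℂ} (ha : 0 < a.re) (hp : 0 < p.re) (n : ℕ) :
    ∫ x in Ioo (0 : ℝ) 1, (x : ℂ) ^ n * betaWeight a p x =
      Gamma p * (Gamma (a + n) * (Gamma (a + p + n))⁻¹) := by
  have han : 0 < (a + n).re := by simp; positivity
  have h1 : ∫ x in Ioo (0 : ℝ) 1, (x : ℂ) ^ n * betaWeight a p x = betaIntegral (a + n) p := by
    rw [betaIntegral, intervalIntegral.integral_of_le zero_le_one, integral_Ioc_eq_integral_Ioo]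
    refine setIntegral_congr_fun measurableSet_Ioo fun x hx => ?_
    have hx0 : (x : ℂ) ≠ 0 := by exact_mod_cast hx.1.ne'
    simp only [betaWeight]
    rw [add_sub_right_comm, cpow_add _ _ hx0, cpow_natCast]
    ring
  have h2 : Gamma (a + p + n) ≠ 0 := Gamma_ne_zero_of_re_pos (by simp; positivity)
  rw [h1, ← mul_assoc, eq_mul_inv_iff_mul_eq₀ h2, mul_comm (Gamma p),
    Gamma_mul_Gamma_eq_betaIntegral han hp, mul_comm]
  congr 2
  ring

/-- The coefficients `Γ(a+n) Γ(b+n) Γ(f+n) / (Γ(d+n) Γ(e+n) Γ(g+n))`. -/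
noncomputable def gammaQuot (a b f d e g : ℂ) (n : ℕ) : ℂ :=
  Gamma (a + n) * Gamma (b + n) * Gamma (f + n) *
    ((Gamma (d + n))⁻¹ * (Gamma (e + n))⁻¹ * (Gamma (g + n))⁻¹)

lemma gammaQuot_swap (a b f d e g : ℂ) : gammaQuot b a f e d g = gammaQuot a b f d e g := by
  ext n
  simp only [gammaQuot]
  ring

lemma gammaQuot_contiguous (a b f d e g : ℂ) (n : ℕ) :
    gammaQuot a b f d e g n =
      gammaQuot a b f (d + 1) e (g - 1) n + (d - g + 1) * gammaQuot a b f (d + 1) e g n := by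
  have h1 := one_div_Gamma_eq_self_mul_one_div_Gamma_add_one (d + n)
  have h2 := one_div_Gamma_eq_self_mul_one_div_Gamma_add_one (g - 1 + n)
  rw [show d + n + 1 = d + 1 + n by ring] at h1
  rw [show g - 1 + n + 1 = g + n by ring] at h2
  simp only [gammaQuot, h1, h2]
  ring

/-- The exponential generating function of `B` is entire and has a ray integral. -/
def HasEgfRayIntegral (B : ℕ → ℂ) (c : ℂ) : Prop :=
  (∀ u : ℂ, Summable fun n : ℕ => B n * (u ^ n / n.factorial)) ∧
    HasRayIntegral (fun u => ∑' n : ℕ, B n * (u ^ n / n.factorial)) c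

lemma HasEgfRayIntegral.add_const_mul {A B : ℕ → ℂ} {c : ℂ} (hA : HasEgfRayIntegral A c)
    (hB : HasEgfRayIntegral B c) (k : ℂ) : HasEgfRayIntegral (fun n => A n + k * B n) c := by
  have hsum : ∀ u : ℂ, HasSum (fun n : ℕ => (A n + k * B n) * (u ^ n / n.factorial))
      (∑' n : ℕ, A n * (u ^ n / n.factorial) + k * ∑' n : ℕ, B n * (u ^ n / n.factorial)) :=
    fun u => by
      simp_rw [add_mul, mul_assoc]
      exact (hA.1 u).hasSum.add ((hB.1 u).hasSum.mul_left k)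
  refine ⟨fun u => (hsum u).summable, ?_⟩
  simp_rw [fun u => (hsum u).tsum_eq]
  exact hA.2.add (hB.2.const_mul k)

lemma one_sub_mul_rpow_neg_le {γ η₁ η₂ η₃ : ℝ} (h₁ : 0 ≤ η₁) (h₂ : 0 ≤ η₂) (h₃ : 0 ≤ η₃)
    (hη : η₁ + η₂ + η₃ = γ) {x y z : ℝ} (hx : x ∈ Ioo (0 : ℝ) 1) (hy : y ∈ Ioo (0 : ℝ) 1)
    (hz : z ∈ Ioo (0 : ℝ) 1) :
    (1 - x * (y * z)) ^ (-γ) ≤ (1 - x) ^ (-η₁) * ((1 - y) ^ (-η₂) * (1 - z) ^ (-η₃)) := by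
  obtain ⟨hx0, hx1⟩ := hx
  obtain ⟨hy0, hy1⟩ := hy
  obtain ⟨hz0, hz1⟩ := hz
  have hyz : y * z < y := mul_lt_of_lt_one_right hy0 hz1
  have hyz' : y * z < z := mul_lt_of_lt_one_left hz0 hy1
  have hyz0 : 0 < y * z := mul_pos hy0 hz0
  have hx' : x * (y * z) < x := mul_lt_of_lt_one_right hx0 (by linarith)
  have hyz'' : x * (y * z) < y * z := mul_lt_of_lt_one_left hyz0 hx1
  have h0 : 0 < 1 - x * (y * z) := by linarith
  rw [show -γ = -η₁ + (-η₂ + -η₃) by linarith, Real.rpow_add h0, Real.rpow_add h0]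
  gcongr ?_ * (?_ * ?_)
  · exact Real.rpow_le_rpow_of_nonpos (by linarith) (by linarith) (by linarith)
  · exact Real.rpow_le_rpow_of_nonpos (by linarith) (by linarith) (by linarith)
  · exact Real.rpow_le_rpow_of_nonpos (by linarith) (by linarith) (by linarith)

lemma hasEgfRayIntegral_gammaQuot_of_pos {a b f d e g c : ℂ} (hc : 0 < c.re) (ha : 0 < a.re)
    (hb : 0 < b.re) (hf : 0 < f.re) (hd : a.re < d.re) (he : b.re < e.re) (hg : f.re < g.re)
    (h : (a + b + f + c).re < (d + e + g).re) : HasEgfRayIntegral (gammaQuot a b f d e g) c := by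
  have hp : 0 < (d - a).re := by simpa
  have hq : 0 < (e - b).re := by simpa
  have hr : 0 < (g - f).re := by simpa
  set ν : Measure ℝ := volume.restrict (Ioo 0 1) with hν
  set μ : Measure (ℝ × ℝ × ℝ) := ν.prod (ν.prod ν) with hμ
  set X : ℝ × ℝ × ℝ → ℝ := fun ω => ω.1 * (ω.2.1 * ω.2.2) with hX
  set w : ℝ × ℝ × ℝ → ℂ := fun ω =>
    betaWeight a (d - a) ω.1 * (betaWeight b (e - b) ω.2.1 * betaWeight f (g - f) ω.2.2) with hw
  have hmem : ∀ᵐ ω ∂μ, ω.1 ∈ Ioo (0 : ℝ) 1 ∧ ω.2.1 ∈ Ioo (0 : ℝ) 1 ∧ ω.2.2 ∈ Ioo (0 : ℝ) 1 := by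
    have h1 : μ = (volume.prod (volume.prod volume)).restrict
        (Ioo (0 : ℝ) 1 ×ˢ (Ioo (0 : ℝ) 1 ×ˢ Ioo (0 : ℝ) 1)) := by
      rw [hμ, hν, Measure.prod_restrict, Measure.prod_restrict]
    rw [h1]
    filter_upwards [ae_restrict_mem (measurableSet_Ioo.prod
      (measurableSet_Ioo.prod measurableSet_Ioo))] with ω hω
    exact ⟨hω.1, hω.2.1, hω.2.2⟩
  have hX01 : ∀ᵐ ω ∂μ, 0 < X ω ∧ X ω < 1 := by
    filter_upwards [hmem] with ω ⟨h1, h2, h3⟩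
    exact ⟨mul_pos h1.1 (mul_pos h2.1 h3.1),
      mul_lt_one_of_nonneg_of_lt_one_left h1.1.le h1.2
        (mul_lt_one_of_nonneg_of_lt_one_left h2.1.le h2.2 h3.2.le).le⟩
  have hXm : Measurable X := by fun_prop
  have hwm : Measurable w :=
    ((measurable_betaWeight _ _).comp measurable_fst).mul
      (((measurable_betaWeight _ _).comp (measurable_fst.comp measurable_snd)).mul
        ((measurable_betaWeight _ _).comp (measurable_snd.comp measurable_snd)))
  have hwint : Integrable w μ :=
    (integrableOn_betaWeight ha hp).mul_prod
      ((integrableOn_betaWeight hb hq).mul_prod (integrableOn_betaWeight hf hr))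
  have hint : Integrable (fun ω => (1 - X ω) ^ (-c.re) * ‖w ω‖) μ := by
    set S := (d - a).re + (e - b).re + (g - f).re with hS
    have hS0 : 0 < S := by positivity
    have hcS : c.re / S < 1 := by
      rw [div_lt_one hS0, hS]
      simp only [add_re, sub_re] at h ⊢
      linarith
    have hη : ∀ r : ℝ, 0 < r → c.re / S * r < r := fun r hr => mul_lt_of_lt_one_left hr hcS
    refine ((integrableOn_rpow_mul_norm_betaWeight ha (hη _ hp)).mul_prod
      ((integrableOn_rpow_mul_norm_betaWeight hb (hη _ hq)).mul_prod
        (integrableOn_rpow_mul_norm_betaWeight hf (hη _ hr)))).mono'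
      (by fun_prop) ?_
    filter_upwards [hmem, hX01] with ω ⟨h1, h2, h3⟩ hω
    have h0 : 0 ≤ (1 - X ω) ^ (-c.re) := Real.rpow_nonneg (by linarith [hω.2]) _
    rw [norm_mul, norm_norm, Real.norm_of_nonneg h0]
    refine (mul_le_mul_of_nonneg_right (one_sub_mul_rpow_neg_le (γ := c.re)
      (η₁ := c.re / S * (d - a).re) (η₂ := c.re / S * (e - b).re) (η₃ := c.re / S * (g - f).re)
      (by positivity) (by positivity) (by positivity) ?_ h1 h2 h3) (norm_nonneg (w ω))).trans_eq ?_
    · rw [← mul_add, ← mul_add, ← hS, div_mul_cancel₀ _ hS0.ne']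
    · simp only [hw, norm_mul]
      ring
  set K := Gamma (d - a) * Gamma (e - b) * Gamma (g - f) with hK
  have hK0 : K ≠ 0 := mul_ne_zero (mul_ne_zero (Gamma_ne_zero_of_re_pos hp)
    (Gamma_ne_zero_of_re_pos hq)) (Gamma_ne_zero_of_re_pos hr)
  have hmom : ∀ n : ℕ, ∫ ω, (X ω : ℂ) ^ n * w ω ∂μ = K * gammaQuot a b f d e g n := fun n => by
    have h1 : ∀ ω, (X ω : ℂ) ^ n * w ω = ((ω.1 : ℂ) ^ n * betaWeight a (d - a) ω.1) *
        (((ω.2.1 : ℂ) ^ n * betaWeight b (e - b) ω.2.1) *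
          ((ω.2.2 : ℂ) ^ n * betaWeight f (g - f) ω.2.2)) := fun ω => by
      simp only [hX, hw, ofReal_mul, mul_pow]
      ring
    simp_rw [h1]
    rw [hμ, integral_prod_mul (fun x : ℝ => (x : ℂ) ^ n * betaWeight a (d - a) x)
        (fun y : ℝ × ℝ => ((y.1 : ℂ) ^ n * betaWeight b (e - b) y.1) *
          ((y.2 : ℂ) ^ n * betaWeight f (g - f) y.2)),
      integral_prod_mul (fun x : ℝ => (x : ℂ) ^ n * betaWeight b (e - b) x)
        (fun x : ℝ => (x : ℂ) ^ n * betaWeight f (g - f) x), hν,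
      integral_pow_mul_betaWeight ha hp, integral_pow_mul_betaWeight hb hq,
      integral_pow_mul_betaWeight hf hr]
    simp only [add_sub_cancel, gammaQuot, hK]
    ring
  have hsum : ∀ u : ℂ, HasSum (fun n : ℕ => gammaQuot a b f d e g n * (u ^ n / n.factorial))
      (K⁻¹ * ∫ ω, exp (u * X ω) * w ω ∂μ) := fun u => by
    have := (hasSum_integral_pow_mul hXm (μ := μ) (by
      filter_upwards [hX01] with ω hω
      rw [abs_of_pos hω.1]
      exact hω.2.le) hwint u).mul_left K⁻¹
    refine this.congr_fun fun n => ?_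
    rw [hmom]
    field_simp
  refine ⟨fun u => (hsum u).summable, ?_⟩
  simp_rw [fun u => (hsum u).tsum_eq]
  exact (hasRayIntegral_integral_exp hXm hwm (hX01.mono fun _ h => h.2) hc hint).const_mul _

lemma hasEgfRayIntegral_gammaQuot_of_pos_right {a b f c : ℂ} (hc : 0 < c.re) (ha : 0 < a.re)
    (hb : 0 < b.re) (hf : 0 < f.re) (k : ℕ) {d e g : ℂ} (hd : a.re < d.re + k) (he : b.re < e.re)
    (hg : f.re + k < g.re) (h : (a + b + f + c).re < (d + e + g).re) :
    HasEgfRayIntegral (gammaQuot a b f d e g) c := by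
  induction k generalizing d g with
  | zero =>
    simp only [Nat.cast_zero, add_zero] at hd hg
    exact hasEgfRayIntegral_gammaQuot_of_pos hc ha hb hf hd he hg h
  | succ k ih =>
    rw [funext (gammaQuot_contiguous a b f d e g)]
    push_cast at hd hg
    simp only [add_re] at h
    refine (ih ?_ ?_ ?_).add_const_mul (ih ?_ ?_ ?_) _ <;>
      first | linarith | (simp only [add_re, sub_re, one_re]; linarith)

lemma hasEgfRayIntegral_gammaQuot {a b f c : ℂ} (hc : 0 < c.re) (ha : 0 < a.re)
    (hb : 0 < b.re) (hf : 0 < f.re) (k l : ℕ) {d e g : ℂ} (hd : a.re < d.re + k)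
    (he : b.re < e.re + l) (hg : f.re + k + l < g.re)
    (h : (a + b + f + c).re < (d + e + g).re) :
    HasEgfRayIntegral (gammaQuot a b f d e g) c := by
  induction l generalizing e g with
  | zero =>
    simp only [Nat.cast_zero, add_zero] at he hg
    exact hasEgfRayIntegral_gammaQuot_of_pos_right hc ha hb hf k hd he hg h
  | succ l ih =>
    rw [← gammaQuot_swap, funext (gammaQuot_contiguous b a f e d g)]
    simp only [gammaQuot_swap a b f d (e + 1)]
    push_cast at he hg
    simp only [add_re] at h
    refine (ih ?_ ?_ ?_).add_const_mul (ih ?_ ?_ ?_) _ <;>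
      first | linarith | (simp only [add_re, sub_re, one_re]; linarith)

/-! ### The Laplace transform of the hypergeometric function -/

lemma hyp_two_two (a b d e u : ℂ) : hyp [a, b] [d, e] u =
    ∑' n : ℕ, poch a n * poch b n / (poch d n * poch e n) * (u ^ n / n.factorial) := by
  simp only [hyp, List.map_cons, List.map_nil, List.prod_cons, List.prod_nil, mul_one]
  refine tsum_congr fun n => ?_
  rw [mul_comm_div, ← div_div, div_mul_div_comm, div_div, mul_div_assoc']

lemma poch_add (a : ℂ) (m n : ℕ) : poch a (m + n) = poch a m * poch (a + m) n := by
  induction n with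
  | zero => simp [poch_zero]
  | succ n ih =>
    rw [← add_assoc, poch_succ, poch_succ, ih]
    push_cast
    ring

lemma ne_neg_natCast_of_re_pos {z : ℂ} (hz : 0 < z.re) (n : ℕ) : z ≠ -(n : ℂ) := by
  rintro rfl
  simp at hz
  linarith [n.cast_nonneg (α := ℝ)]

lemma poch_add_eq_Gamma {a : ℂ} {M : ℕ} (ha : 0 < (a + M).re) (m : ℕ) :
    poch a (M + m) = poch a M * (Gamma (a + M + m) * (Gamma (a + M))⁻¹) := by
  rw [poch_add, ← poch_mul_Gamma (ne_neg_natCast_of_re_pos ha),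
    mul_inv_cancel_right₀ (Gamma_ne_zero_of_re_pos ha)]

lemma hypTerm_shift_eq_gammaQuot {a b d e : ℂ} {M : ℕ} (ha : 0 < (a + M).re)
    (hb : 0 < (b + M).re) (hd : 0 < (d + M).re) (he : 0 < (e + M).re) (m : ℕ) :
    poch a (m + M) * poch b (m + M) / (poch d (m + M) * poch e (m + M)) / (m + M).factorial =
      poch a M * poch b M / (poch d M * poch e M) *
        (Gamma (d + M) * Gamma (e + M) * ((Gamma (a + M))⁻¹ * (Gamma (b + M))⁻¹)) *
        (gammaQuot (a + M) (b + M) 1 (d + M) (e + M) (M + 1) m / m.factorial) := by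
  have h1 : Gamma (1 + (m : ℂ)) = m.factorial := by rw [add_comm, Gamma_nat_eq_factorial]
  have h2 : Gamma ((M : ℂ) + 1 + m) = (m + M).factorial := by
    rw [← Gamma_nat_eq_factorial, Nat.cast_add, add_right_comm, add_comm (m : ℂ)]
  have h3 : (m.factorial : ℂ) ≠ 0 := by exact_mod_cast m.factorial_ne_zero
  have h4 : gammaQuot (a + M) (b + M) 1 (d + M) (e + M) (M + 1) m / m.factorial =
      Gamma (a + M + m) * Gamma (b + M + m) *
        ((Gamma (d + M + m))⁻¹ * (Gamma (e + M + m))⁻¹ * ((m + M).factorial : ℂ)⁻¹) := by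
    rw [gammaQuot, h1, h2, mul_right_comm, mul_div_cancel_right₀ _ h3]
  rw [h4]
  generalize ((m + M).factorial : ℂ) = q
  rw [add_comm m M, poch_add_eq_Gamma ha, poch_add_eq_Gamma hb,
    poch_add_eq_Gamma hd, poch_add_eq_Gamma he]
  simp only [div_eq_mul_inv, mul_inv, inv_inv]
  ring

lemma exists_nat_sub_lt (x y : ℝ) : ∃ k : ℕ, x < y + k := by
  obtain ⟨k, hk⟩ := exists_nat_gt (x - y)
  exact ⟨k, by linarith⟩

lemma hasRayIntegral_hyp {a b c d e : ℂ} (hc : 0 < c.re) (h : (a + b + c).re < (d + e).re) :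
    HasRayIntegral (hyp [a, b] [d, e]) c := by
  obtain ⟨k, hk⟩ := exists_nat_sub_lt a.re d.re
  obtain ⟨l, hl⟩ := exists_nat_sub_lt b.re e.re
  obtain ⟨Na, ha⟩ := exists_nat_re_add_pos a
  obtain ⟨Nb, hb⟩ := exists_nat_re_add_pos b
  obtain ⟨Nd, hd⟩ := exists_nat_re_add_pos d
  obtain ⟨Ne, he⟩ := exists_nat_re_add_pos e
  set M := Na + Nb + Nd + Ne + k + l + 1 with hM
  replace ha := ha M (by omega)
  replace hb := hb M (by omega)
  replace hd := hd M (by omega)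
  replace he := he M (by omega)
  have hkl : (k : ℝ) + l < M := by
    exact_mod_cast (by omega : k + l < M)
  clear_value M
  have hB : HasEgfRayIntegral (gammaQuot (a + M) (b + M) 1 (d + M) (e + M) (M + 1)) (c + M) := by
    refine hasEgfRayIntegral_gammaQuot (by simp; positivity) ha hb (by simp) k l ?_ ?_ ?_ ?_ <;>
      simp at h ⊢ <;> linarith
  set A : ℕ → ℂ := fun n => poch a n * poch b n / (poch d n * poch e n) with hA
  set K : ℂ := A M * (Gamma (d + M) * Gamma (e + M) * ((Gamma (a + M))⁻¹ * (Gamma (b + M))⁻¹))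
    with hK
  have hterm : ∀ (u : ℂ) (m : ℕ), A (m + M) * (u ^ (m + M) / (m + M).factorial) =
      K * (u ^ M * (gammaQuot (a + M) (b + M) 1 (d + M) (e + M) (M + 1) m *
        (u ^ m / m.factorial))) := fun u m => by
    rw [mul_div_left_comm, hypTerm_shift_eq_gammaQuot ha hb hd he, pow_add]
    ring
  have hsum : ∀ u : ℂ, hyp [a, b] [d, e] u =
      ∑ n ∈ Finset.range M, A n / n.factorial * u ^ n + K * (u ^ M *
        ∑' m : ℕ, gammaQuot (a + M) (b + M) 1 (d + M) (e + M) (M + 1) m *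
          (u ^ m / m.factorial)) := fun u => by
    have hs : Summable fun m => A (m + M) * (u ^ (m + M) / (m + M).factorial) := by
      simp_rw [hterm]
      exact ((hB.1 u).mul_left _).mul_left _
    rw [hyp_two_two, ← ((summable_nat_add_iff
      (f := fun n => A n * (u ^ n / n.factorial)) M).1 hs).sum_add_tsum_nat_add M]
    simp_rw [hterm, tsum_mul_left]
    congr 1
    refine Finset.sum_congr rfl fun n _ => ?_
    simp only [hA]
    ring
  rw [funext hsum]
  exact (HasRayIntegral.polynomial hc _ M).add ((hB.2.pow_mul M).const_mul K)

lemma integral_exp_neg_mul_hyp {a b c d e : ℂ} (hc : 0 < c.re)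
    (hd : ∀ n : ℕ, d ≠ -(n : ℂ)) (he : ∀ n : ℕ, e ≠ -(n : ℂ))
    (h : (a + b + c).re < (d + e).re) :
    ∫ t in Ioi (0 : ℝ), exp (-(1 * t)) * (t : ℂ) ^ (c - 1) * hyp [a, b] [d, e] (1 * t) =
      Gamma c * ∑' n, hypTerm a b c d e n := by
  set A : ℕ → ℂ := fun n => poch a n * poch b n / (poch d n * poch e n) / n.factorial with hA
  set F : ℕ → ℝ → ℂ := fun n t => A n * (exp (-(1 * t)) * (t : ℂ) ^ (c + n - 1)) with hF
  have hcn : ∀ n : ℕ, 0 < (c + n).re := fun n => by simp; positivity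
  have hFint : ∀ n, Integrable (F n) (volume.restrict (Ioi 0)) := fun n =>
    (integrableOn_exp_mul_cpow (hcn n) (by simp)).const_mul _
  have hFn : ∀ n, ∫ t in Ioi (0 : ℝ), F n t = Gamma c * hypTerm a b c d e n := fun n => by
    simp only [hF]
    rw [integral_const_mul, integral_exp_mul_cpow (hcn n) (by simp), one_cpow, one_mul,
      ← poch_mul_Gamma (ne_neg_natCast_of_re_pos hc)]
    simp only [hA, hypTerm, div_eq_mul_inv, mul_inv]
    ring
  have hFnorm : ∀ n, ∫ t in Ioi (0 : ℝ), ‖F n t‖ =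
      ‖Gamma (c.re : ℂ)‖ * ‖hypTerm a b c.re d e n‖ := fun n => by
    have h1 : ∫ t in Ioi (0 : ℝ), ‖F n t‖ = ∫ t in Ioi (0 : ℝ),
        ‖A n‖ * (t ^ ((c + n).re - 1) * Real.exp (-(1 * t))) := by
      refine setIntegral_congr_fun measurableSet_Ioi fun t ht => ?_
      simp only [hF]
      rw [norm_mul, norm_exp_mul_cpow _ _ ht, one_re]
    have h2 : Real.Gamma (c + n).re = ‖poch (c.re : ℂ) n * Gamma (c.re : ℂ)‖ := by
      rw [poch_mul_Gamma (ne_neg_natCast_of_re_pos (by simpa using hc)), ← ofReal_natCast,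
        ← ofReal_add, Gamma_ofReal, norm_real, Real.norm_of_nonneg]
      · simp
      · exact (Real.Gamma_pos_of_pos (by positivity)).le
    rw [h1, integral_const_mul, Real.integral_rpow_mul_exp_neg_mul_Ioi (hcn n) one_pos, h2]
    simp only [hA, hypTerm, norm_mul, norm_div, div_one, Real.one_rpow, one_mul]
    ring
  have hS : Summable fun n => ∫ t in Ioi (0 : ℝ), ‖F n t‖ := by
    simp_rw [hFnorm]
    refine Summable.mul_left _ (summable_hypTerm a b c.re hd he ?_).norm
    simpa using h
  have hsum := hasSum_integral_of_summable_integral_norm hFint hS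
  simp_rw [hFn] at hsum
  rw [← tsum_mul_left, hsum.tsum_eq]
  refine setIntegral_congr_fun measurableSet_Ioi fun t ht => ?_
  have ht0 : (t : ℂ) ≠ 0 := by exact_mod_cast (ne_of_gt ht)
  simp only [hF, hyp_two_two]
  rw [← tsum_mul_left]
  refine tsum_congr fun n => ?_
  rw [add_sub_right_comm, cpow_add _ _ ht0, cpow_natCast]
  simp only [hA]
  ring

theorem stmt8 (a b c d e s : ℂ) (hc : 0 < c.re) (hs : 0 < s.re)
    (hab : a + b = 1) (hde : d + e = 1 + 2 * c)
    (hd : (∀ n : ℕ, d ≠ -(n : ℂ))) (he : (∀ n : ℕ, e ≠ -(n : ℂ))) :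
    ∫ t in Ioi (0:ℝ), Complex.exp (-(s * t)) * (t : ℂ) ^ (c - 1) *
        hyp [a, b] [d, e] (s * t)
      = s ^ (-c) * (Real.pi : ℂ) * Complex.Gamma c * Complex.Gamma d * Complex.Gamma e /
          ((2 : ℂ) ^ (2 * c - 1) * Complex.Gamma ((a + d) / 2) * Complex.Gamma ((a + e) / 2) *
            Complex.Gamma ((b + d) / 2) * Complex.Gamma ((b + e) / 2)) := by
  have h : (a + b + c).re < (d + e).re := by
    rw [hab, hde]
    simp
    linarith
  obtain ⟨V, hV⟩ := hasRayIntegral_hyp hc h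
  have h1 := (hV 1 (by simp)).2
  rw [integral_exp_neg_mul_hyp hc hd he h, one_cpow, one_mul,
    tsum_hypTerm_eq_whippleValue hc hab hde hd he] at h1
  have h2 : (2 : ℂ) ^ (1 - 2 * c) = (2 ^ (2 * c - 1))⁻¹ := by rw [← cpow_neg, neg_sub]
  rw [(hV s hs).2, ← h1, whippleValue, h2]
  simp only [div_eq_mul_inv, mul_inv]
  ring
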